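/- arXiv:1112.3644 — 5 statements merged into one kernel-verified Lean document; each statement's English description precedes it below -/
import Mathlib

section
/- There exist constants α > 0, δ > 0, and s₀ (depending only on c and κ) such that the following holds. Let d_1, …, d_r be positive integers with s = (1/2)·Σ_{i=1}^r d_i ≥ s₀, let j denote the number of indices i with d_i = 1, and assume (i) Σ_{i : d_i ≥ 2} d_i² ≥ c·j, and (ii) the expected triangle count of the CL model satisfies T ≥ (κ/3)·Σ_{i=1}^r binom(d_i, 2), where binom(1,2) = 0. Then the number of indices i with d_i ≥ δ·√s is at least α·√s. -/
open Finset

/-- Edge probability of the Chung–Lu model: `p i j = min 1 (d i * d j / (2 s))`. -/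
noncomputable def clP {r : ℕ} (d : Fin r → ℕ) (s : ℝ) (i j : Fin r) : ℝ :=
  min 1 ((d i : ℝ) * (d j : ℝ) / (2 * s))

/-- Expected triangle count of the Chung–Lu model:
`T = ∑_{i < j < k} p i j * p j k * p i k`. -/
noncomputable def clT {r : ℕ} (d : Fin r → ℕ) (s : ℝ) : ℝ :=
  ∑ t ∈ Finset.univ.filter
      (fun t : Fin r × Fin r × Fin r => t.1 < t.2.1 ∧ t.2.1 < t.2.2),
    clP d s t.1 t.2.1 * clP d s t.2.1 t.2.2 * clP d s t.1 t.2.2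

section CappedProductKernel

variable {ι : Type*} [Fintype ι] {x : ι → ℝ} {p : ι → ι → ℝ} {q : ℝ}

/-- The triangles with a vertex in `L` are controlled by the degree-weighted average of `p`. -/
lemma sum_triangle_le_weighted (hq : 0 < q) (hp0 : ∀ i j, 0 ≤ p i j)
    (hpx : ∀ i j, p i j ≤ x i * x j / (2 * q ^ 2)) (L : Finset ι) :
    ∑ i ∈ L, ∑ j, ∑ k, p i j * p i k * p j k ≤
      (∑ i ∈ L, x i ^ 2) * ((∑ j, ∑ k, x j * x k * p j k) / (4 * q ^ 4)) := by
  rw [Finset.sum_mul]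
  refine Finset.sum_le_sum fun i _ => ?_
  rw [Finset.sum_div, Finset.mul_sum]
  refine Finset.sum_le_sum fun j _ => ?_
  rw [Finset.sum_div, Finset.mul_sum]
  refine Finset.sum_le_sum fun k _ => ?_
  have h : p i j * p i k ≤ x i * x j / (2 * q ^ 2) * (x i * x k / (2 * q ^ 2)) :=
    mul_le_mul (hpx i j) (hpx i k) (hp0 i k) ((hp0 i j).trans (hpx i j))
  calc p i j * p i k * p j k
      ≤ x i * x j / (2 * q ^ 2) * (x i * x k / (2 * q ^ 2)) * p j k :=
        mul_le_mul_of_nonneg_right h (hp0 j k)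
    _ = _ := by field_simp; ring

lemma sum_weighted_le_sq (hx : ∀ i, 0 ≤ x i) (hp1 : ∀ i j, p i j ≤ 1)
    (hsum : ∑ i, x i = 2 * q ^ 2) :
    ∑ j, ∑ k, x j * x k * p j k ≤ 4 * q ^ 4 := by
  calc ∑ j, ∑ k, x j * x k * p j k ≤ ∑ j, ∑ k, x j * x k :=
        Finset.sum_le_sum fun j _ => Finset.sum_le_sum fun k _ =>
          mul_le_of_le_one_right (mul_nonneg (hx j) (hx k)) (hp1 j k)
    _ = (∑ j, x j) * ∑ k, x k := (Finset.sum_mul_sum _ _ _ _).symm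
    _ = 4 * q ^ 4 := by rw [hsum]; ring

/-- The weighted average of `p` is small when the vertices of large degree carry little weight. -/
lemma sum_weighted_le_of_large (hq : 0 < q) {δ : ℝ} (hδ : 0 < δ) (hx : ∀ i, 0 ≤ x i)
    (hp1 : ∀ i j, p i j ≤ 1) (hpx : ∀ i j, p i j ≤ x i * x j / (2 * q ^ 2))
    (hsum : ∑ i, x i = 2 * q ^ 2) :
    ∑ j, ∑ k, x j * x k * p j k ≤
      4 * q ^ 2 * (∑ i with δ * q ≤ x i, x i) + δ ^ 2 / 2 * (4 * q ^ 4) := by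
  set u : ι → ℝ := fun i => if δ * q ≤ x i then 1 else 0 with hu
  have hu0 : ∀ i, 0 ≤ u i := fun i => by simp only [hu]; split_ifs <;> norm_num
  have hpu : ∀ j k, p j k ≤ u j + u k + δ ^ 2 / 2 := by
    intro j k
    by_cases hj : δ * q ≤ x j
    · have : u j = 1 := if_pos hj
      have := hu0 k
      have := hp1 j k
      nlinarith [sq_nonneg δ]
    by_cases hk : δ * q ≤ x k
    · have : u k = 1 := if_pos hk
      have := hu0 j
      have := hp1 j k
      nlinarith [sq_nonneg δ]
    have h1 : x j * x k ≤ (δ * q) * (δ * q) :=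
      mul_le_mul (not_le.1 hj).le (not_le.1 hk).le (hx k) (by positivity)
    have h2 : x j * x k / (2 * q ^ 2) ≤ δ ^ 2 / 2 := by
      rw [div_le_iff₀ (by positivity)]
      nlinarith
    linarith [hu0 j, hu0 k, hpx j k]
  have hU : ∑ i with δ * q ≤ x i, x i = ∑ i, x i * u i := by
    rw [Finset.sum_filter]
    exact Finset.sum_congr rfl fun i _ => by simp only [hu]; split_ifs <;> simp
  calc ∑ j, ∑ k, x j * x k * p j k
      ≤ ∑ j, ∑ k, ((x j * u j) * x k + x j * (x k * u k) + δ ^ 2 / 2 * (x j * x k)) :=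
        Finset.sum_le_sum fun j _ => Finset.sum_le_sum fun k _ => by
          nlinarith [mul_le_mul_of_nonneg_left (hpu j k) (mul_nonneg (hx j) (hx k))]
    _ = (∑ j, x j * u j) * (∑ k, x k) + (∑ j, x j) * (∑ k, x k * u k)
          + δ ^ 2 / 2 * ((∑ j, x j) * ∑ k, x k) := by
        rw [Finset.sum_mul_sum, Finset.sum_mul_sum, Finset.sum_mul_sum]
        simp only [Finset.sum_add_distrib, Finset.mul_sum]
    _ = _ := by rw [hsum, hU]; ring

/-- If few vertices have degree of order `q`, then vertices of small degree see few triangles,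
relative to the sum of squared degrees. -/
lemma sum_triangle_small_le (hq : 0 < q) {α δ η : ℝ} (hδ : 0 < δ) (hη : 0 < η)
    (hx : ∀ i, 0 ≤ x i) (hp0 : ∀ i j, 0 ≤ p i j) (hp1 : ∀ i j, p i j ≤ 1)
    (hpx : ∀ i j, p i j ≤ x i * x j / (2 * q ^ 2)) (hsum : ∑ i, x i = 2 * q ^ 2)
    (hcard : ((univ.filter fun i => δ * q ≤ x i).card : ℝ) ≤ α * q) :
    ∑ i with ¬ δ * q ≤ x i, ∑ j, ∑ k, p i j * p i k * p j k ≤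
      max (η + δ ^ 2 / 2) (2 * δ * α / η ^ 2) * ∑ i, x i ^ 2 := by
  set S := ∑ i, x i ^ 2
  have hS : 0 ≤ S := Finset.sum_nonneg fun i _ => sq_nonneg _
  set A := ∑ i with ¬ δ * q ≤ x i, x i ^ 2
  have hA0 : 0 ≤ A := Finset.sum_nonneg fun i _ => sq_nonneg _
  have hAS : A ≤ S := Finset.sum_le_sum_of_subset_of_nonneg (Finset.filter_subset _ _)
    fun i _ _ => sq_nonneg _
  have hmain := sum_triangle_le_weighted hq hp0 hpx (univ.filter fun i => ¬ δ * q ≤ x i)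
  refine hmain.trans ?_
  set D := ∑ i with δ * q ≤ x i, x i
  rcases le_or_gt D (η * q ^ 2) with h | h
  · have hW := sum_weighted_le_of_large hq hδ hx hp1 hpx hsum
    have hle : (∑ j, ∑ k, x j * x k * p j k) / (4 * q ^ 4) ≤ η + δ ^ 2 / 2 := by
      rw [div_le_iff₀ (by positivity)]
      nlinarith [mul_le_mul_of_nonneg_left h (by positivity : 0 ≤ 4 * q ^ 2)]
    calc A * _ ≤ A * (η + δ ^ 2 / 2) := mul_le_mul_of_nonneg_left hle hA0
      _ ≤ S * (η + δ ^ 2 / 2) := mul_le_mul_of_nonneg_right hAS (by positivity)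
      _ = (η + δ ^ 2 / 2) * S := mul_comm _ _
      _ ≤ _ := mul_le_mul_of_nonneg_right (le_max_left _ _) hS
  · have hW := sum_weighted_le_sq hx hp1 hsum
    have hle : (∑ j, ∑ k, x j * x k * p j k) / (4 * q ^ 4) ≤ 1 := by
      rw [div_le_iff₀ (by positivity)]
      linarith
    have hAq : A ≤ 2 * δ * q ^ 3 := by
      calc A ≤ ∑ i with ¬ δ * q ≤ x i, δ * q * x i :=
            Finset.sum_le_sum fun i hi => by
              rw [sq]
              exact mul_le_mul_of_nonneg_right (not_le.1 (Finset.mem_filter.1 hi).2).le (hx i)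
        _ ≤ ∑ i, δ * q * x i := Finset.sum_le_sum_of_subset_of_nonneg (Finset.filter_subset _ _)
            fun i _ _ => mul_nonneg (by positivity) (hx i)
        _ = 2 * δ * q ^ 3 := by rw [← Finset.mul_sum, hsum]; ring
    have hcs : D ^ 2 ≤ α * q * S := by
      refine sq_sum_le_card_mul_sum_sq.trans (mul_le_mul hcard ?_ ?_ ?_)
      · exact Finset.sum_le_sum_of_subset_of_nonneg (Finset.filter_subset _ _)
          fun i _ _ => sq_nonneg _
      · exact Finset.sum_nonneg fun i _ => sq_nonneg _
      · exact (Nat.cast_nonneg _).trans hcard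
    have hDsq : (η * q ^ 2) ^ 2 ≤ D ^ 2 := pow_le_pow_left₀ (by positivity) h.le 2
    have hqS : η ^ 2 * q ^ 3 ≤ α * S := by
      refine le_of_mul_le_mul_right ?_ hq
      nlinarith
    calc A * _ ≤ A * 1 := mul_le_mul_of_nonneg_left hle hA0
      _ ≤ 2 * δ * q ^ 3 := by linarith
      _ ≤ 2 * δ * α / η ^ 2 * S := by
        rw [div_mul_eq_mul_div, le_div_iff₀ (by positivity)]
        nlinarith [mul_le_mul_of_nonneg_left hqS (by positivity : 0 ≤ 2 * δ)]
      _ ≤ _ := mul_le_mul_of_nonneg_right (le_max_right _ _) hS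

/-- Triangles among the vertices of large degree. -/
lemma sum_triangle_large_le (hq : 0 < q) {α δ : ℝ} (hδ : 0 < δ)
    (hp0 : ∀ i j, 0 ≤ p i j) (hp1 : ∀ i j, p i j ≤ 1)
    (hcard : ((univ.filter fun i => δ * q ≤ x i).card : ℝ) ≤ α * q) :
    ∑ i with δ * q ≤ x i, ∑ j with δ * q ≤ x j, ∑ k with δ * q ≤ x k, p i j * p i k * p j k ≤
      (α / δ) ^ 2 * ∑ i, x i ^ 2 := by
  set H := univ.filter fun i => δ * q ≤ x i
  have h1 : ∑ i ∈ H, ∑ j ∈ H, ∑ k ∈ H, p i j * p i k * p j k ≤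
      ∑ i ∈ H, ∑ j ∈ H, ∑ k ∈ H, (1 : ℝ) :=
    Finset.sum_le_sum fun i _ => Finset.sum_le_sum fun j _ => Finset.sum_le_sum fun k _ =>
      mul_le_one₀ (mul_le_one₀ (hp1 i j) (hp0 i k) (hp1 i k)) (hp0 j k) (hp1 j k)
  have h2 : (H.card : ℝ) * (δ * q) ^ 2 ≤ ∑ i, x i ^ 2 := by
    calc (H.card : ℝ) * (δ * q) ^ 2 = ∑ i ∈ H, (δ * q) ^ 2 := by simp
      _ ≤ ∑ i ∈ H, x i ^ 2 := Finset.sum_le_sum fun i hi =>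
          pow_le_pow_left₀ (by positivity) (Finset.mem_filter.1 hi).2 2
      _ ≤ _ := Finset.sum_le_sum_of_subset_of_nonneg (Finset.filter_subset _ _)
          fun i _ _ => sq_nonneg _
  have h3 : (H.card : ℝ) ^ 2 ≤ (α * q) ^ 2 := pow_le_pow_left₀ (Nat.cast_nonneg _) hcard 2
  calc _ ≤ ∑ i ∈ H, ∑ j ∈ H, ∑ k ∈ H, (1 : ℝ) := h1
    _ = (H.card : ℝ) * (H.card : ℝ) ^ 2 := by
        simp only [Finset.sum_const, nsmul_eq_mul, mul_one]; ring
    _ ≤ (H.card : ℝ) * (α * q) ^ 2 := mul_le_mul_of_nonneg_left h3 (Nat.cast_nonneg _)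
    _ = (α / δ) ^ 2 * ((H.card : ℝ) * (δ * q) ^ 2) := by field_simp
    _ ≤ _ := mul_le_mul_of_nonneg_left h2 (by positivity)

/-- A triple either lies entirely in the set where `P` holds, or one of its entries does not. -/
lemma sum_triangle_le_split (hp0 : ∀ i j, 0 ≤ p i j) (hsymm : ∀ i j, p i j = p j i)
    (P : ι → Prop) [DecidablePred P] :
    ∑ i, ∑ j, ∑ k, p i j * p i k * p j k ≤
      (∑ i with P i, ∑ j with P j, ∑ k with P k, p i j * p i k * p j k) +
        3 * ∑ i with ¬ P i, ∑ j, ∑ k, p i j * p i k * p j k := by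
  set f : ι → ι → ι → ℝ := fun i j k => p i j * p i k * p j k with hf
  have hf0 : ∀ i j k, 0 ≤ f i j k := fun i j k =>
    mul_nonneg (mul_nonneg (hp0 i j) (hp0 i k)) (hp0 j k)
  have h2 : ∑ i, ∑ j with ¬ P j, ∑ k, f i j k = ∑ i with ¬ P i, ∑ j, ∑ k, f i j k := by
    rw [Finset.sum_comm]
    refine Finset.sum_congr rfl fun j _ => Finset.sum_congr rfl fun i _ =>
      Finset.sum_congr rfl fun k _ => ?_
    simp only [hf, hsymm i j]; ring
  have h3 : ∑ i, ∑ j, ∑ k with ¬ P k, f i j k = ∑ i with ¬ P i, ∑ j, ∑ k, f i j k := by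
    simp_rw [fun i => Finset.sum_comm (s := univ) (t := univ.filter fun k => ¬ P k) (f := f i)]
    rw [Finset.sum_comm]
    refine Finset.sum_congr rfl fun k _ => Finset.sum_congr rfl fun i _ =>
      Finset.sum_congr rfl fun j _ => ?_
    simp only [hf, hsymm i k, hsymm j k]; ring
  have hsplit : ∀ i j k, f i j k ≤ (if P i then if P j then if P k then f i j k else 0 else 0 else 0)
      + (if ¬ P i then f i j k else 0) + (if ¬ P j then f i j k else 0)
      + (if ¬ P k then f i j k else 0) := by
    intro i j k
    have := hf0 i j k
    split_ifs <;> linarith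
  have key := Finset.sum_le_sum fun i (_ : i ∈ univ) => Finset.sum_le_sum fun j (_ : j ∈ univ) =>
    Finset.sum_le_sum fun k (_ : k ∈ univ) => hsplit i j k
  simp only [Finset.sum_add_distrib] at key
  have e0 : ∑ i, ∑ j, ∑ k, (if P i then if P j then if P k then f i j k else 0 else 0 else 0) =
      ∑ i with P i, ∑ j with P j, ∑ k with P k, f i j k := by
    simp only [Finset.sum_filter]
    refine Finset.sum_congr rfl fun i _ => ?_
    split_ifs
    · refine Finset.sum_congr rfl fun j _ => ?_
      split_ifs <;> simp
    · simp
  have e1 : ∑ i, ∑ j, ∑ k, (if ¬ P i then f i j k else 0) =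
      ∑ i with ¬ P i, ∑ j, ∑ k, f i j k := by
    rw [Finset.sum_filter]
    exact Finset.sum_congr rfl fun i _ => by split_ifs <;> simp
  have e2 : ∑ i, ∑ j, ∑ k, (if ¬ P j then f i j k else 0) =
      ∑ i, ∑ j with ¬ P j, ∑ k, f i j k := by
    refine Finset.sum_congr rfl fun i _ => ?_
    rw [Finset.sum_filter]
    exact Finset.sum_congr rfl fun i _ => by split_ifs <;> simp
  have e3 : ∑ i, ∑ j, ∑ k, (if ¬ P k then f i j k else 0) =
      ∑ i, ∑ j, ∑ k with ¬ P k, f i j k := by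
    simp only [Finset.sum_filter]
  rw [e0, e1, e2, e3, h2, h3] at key
  linarith

end CappedProductKernel

lemma clT_le_sum {r : ℕ} (d : Fin r → ℕ) {s : ℝ} (hs : 0 ≤ s) :
    clT d s ≤ ∑ i, ∑ j, ∑ k, clP d s i j * clP d s i k * clP d s j k := by
  have h0 : ∀ i j, 0 ≤ clP d s i j := fun i j => le_min zero_le_one (by positivity)
  unfold clT
  refine (Finset.sum_le_sum_of_subset_of_nonneg (Finset.subset_univ _)
    fun t _ _ => mul_nonneg (mul_nonneg (h0 _ _) (h0 _ _)) (h0 _ _)).trans_eq ?_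
  rw [Fintype.sum_prod_type]
  refine Finset.sum_congr rfl fun i _ => ?_
  rw [Fintype.sum_prod_type]
  exact Finset.sum_congr rfl fun j _ => Finset.sum_congr rfl fun k _ => by ring

lemma sum_sq_le_sum_choose_two {ι : Type*} [Fintype ι] {c : ℝ} (hc : 0 < c) (d : ι → ℕ)
    (hd : ∀ i, 0 < d i)
    (h : c * ((univ.filter fun i => d i = 1).card : ℝ) ≤ ∑ i with 2 ≤ d i, (d i : ℝ) ^ 2) :
    c * ∑ i, (d i : ℝ) ^ 2 ≤ 4 * (c + 1) * ∑ i, ((d i).choose 2 : ℝ) := by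
  have hsplit : ∑ i, (d i : ℝ) ^ 2 =
      (∑ i with 2 ≤ d i, (d i : ℝ) ^ 2) + ((univ.filter fun i => d i = 1).card : ℝ) := by
    rw [← Finset.sum_filter_add_sum_filter_not univ (fun i => 2 ≤ d i)]
    congr 1
    have hone : (univ.filter fun i => ¬ 2 ≤ d i) = univ.filter fun i => d i = 1 :=
      Finset.filter_congr fun i _ => by have := hd i; omega
    rw [hone, Finset.card_eq_sum_ones, Nat.cast_sum]
    exact Finset.sum_congr rfl fun i hi => by simp [(Finset.mem_filter.1 hi).2]
  have hchoose : ∑ i with 2 ≤ d i, (d i : ℝ) ^ 2 ≤ 4 * ∑ i, ((d i).choose 2 : ℝ) := by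
    rw [Finset.mul_sum]
    refine (Finset.sum_le_sum fun i hi => ?_).trans
      (Finset.sum_le_sum_of_subset_of_nonneg (Finset.filter_subset _ _) fun i _ _ => by positivity)
    have h2 : (2 : ℝ) ≤ d i := by exact_mod_cast (Finset.mem_filter.1 hi).2
    rw [Nat.cast_choose_two]
    nlinarith
  rw [hsplit]
  nlinarith

/-- There are constants `α, δ > 0` and `s₀` (depending only on `c` and `κ`) such that:
for every degree sequence of positive integers with `s = (∑ d i)/2 ≥ s₀`, if
`∑_{d i ≥ 2} d i ^ 2 ≥ c j` (where `j` is the number of degree-1 indices) and the expected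
triangle count of the CL model satisfies `T ≥ (κ/3) ∑ binom(d i, 2)`, then at least
`α √s` of the indices have `d i ≥ δ √s`. -/
theorem community_contains_dense_er (c : ℝ) (hc : 0 < c) (κ : ℝ) (hκ0 : 0 < κ) (hκ1 : κ < 1) :
    ∃ α δ s₀ : ℝ, 0 < α ∧ 0 < δ ∧
      ∀ (r : ℕ) (d : Fin r → ℕ), (∀ i, 0 < d i) →
        ∀ s : ℝ, s = (∑ i, (d i : ℝ)) / 2 → s₀ ≤ s →
        (∑ i ∈ Finset.univ.filter (fun i => 2 ≤ d i), (d i : ℝ) ^ 2) ≥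
          c * ((Finset.univ.filter (fun i => d i = 1)).card : ℝ) →
        clT d s ≥ (κ / 3) * ∑ i, ((d i).choose 2 : ℝ) →
        α * Real.sqrt s ≤
          ((Finset.univ.filter (fun i => δ * Real.sqrt s ≤ (d i : ℝ))).card : ℝ) := by
  set m : ℝ := κ * c / (12 * (c + 1)) with hm
  have hm0 : 0 < m := by positivity
  have hm1 : m < 1 := by
    rw [hm, div_lt_one (by positivity)]
    nlinarith
  refine ⟨m ^ 2 / 288, m / 12, 1, by positivity, by positivity, ?_⟩
  intro r d hd s hs hs1 hsq hT
  by_contra! hcard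
  have hspos : 0 < s := by linarith
  set q := Real.sqrt s
  have hq : 0 < q := Real.sqrt_pos.2 hspos
  have hqs : q ^ 2 = s := Real.sq_sqrt hspos.le
  have hsum : ∑ i, (d i : ℝ) = 2 * q ^ 2 := by rw [hqs]; linarith
  have hp0 : ∀ i j, 0 ≤ clP d s i j := fun i j => le_min zero_le_one (by positivity)
  have hp1 : ∀ i j, clP d s i j ≤ 1 := fun i j => min_le_left _ _
  have hpx : ∀ i j, clP d s i j ≤ (d i : ℝ) * d j / (2 * q ^ 2) := fun i j => by
    rw [hqs]; exact min_le_right _ _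
  have hsymm : ∀ i j, clP d s i j = clP d s j i := fun i j => by
    simp only [clP, mul_comm (d i : ℝ)]
  set S := ∑ i, (d i : ℝ) ^ 2
  have hSpos : 0 < S := by
    have hle : ∑ i, (d i : ℝ) ≤ S := Finset.sum_le_sum fun i _ => by
      have : (1 : ℝ) ≤ d i := by exact_mod_cast hd i
      nlinarith
    have : 0 < q ^ 2 := by positivity
    linarith
  have hlower : m * S ≤ clT d s := by
    refine le_trans ?_ hT
    have h := sum_sq_le_sum_choose_two hc d hd hsq
    rw [hm, div_mul_eq_mul_div, div_le_iff₀ (by positivity)]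
    nlinarith [mul_le_mul_of_nonneg_left h hκ0.le]
  have hsmall := sum_triangle_small_le (η := m / 12) hq (by positivity : 0 < m / 12)
    (by positivity) (fun i => Nat.cast_nonneg (d i)) hp0 hp1 hpx hsum hcard.le
  have hlarge := sum_triangle_large_le hq
    (by positivity : 0 < m / 12) hp0 hp1 hcard.le
  have hsplit := sum_triangle_le_split hp0 hsymm (fun i => m / 12 * q ≤ (d i : ℝ))
  have hupper := clT_le_sum d hspos.le
  have hmax : max (m / 12 + (m / 12) ^ 2 / 2) (2 * (m / 12) * (m ^ 2 / 288) / (m / 12) ^ 2)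
      ≤ m / 8 := by
    refine max_le (by nlinarith) (le_of_eq_of_le (b := m / 12) ?_ (by linarith))
    field_simp
    norm_num
  have hratio : (m ^ 2 / 288 / (m / 12)) ^ 2 ≤ m / 4 := by
    have : m ^ 2 / 288 / (m / 12) = m / 24 := by field_simp; norm_num
    rw [this]
    nlinarith
  have h1 := mul_le_mul_of_nonneg_right hmax hSpos.le
  have h2 := mul_le_mul_of_nonneg_right hratio hSpos.le
  nlinarith [mul_pos hm0 hSpos]
end

section
/- Every finite simple graph with m edges contains at most m^{3/2} triangles (Kruskal–Katona theorem, triangle form). -/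
open Finset in
/-- A discrete Loomis–Whitney inequality for a relation: the number of triples `(a, b, c)` with
`r a b`, `r a c` and `r b c` is at most the `3/2` power of the number of related pairs. -/
theorem sq_sum_card_common_le_card_pow_three {V : Type*} [Fintype V] (r : V → V → Prop)
    [DecidableRel r] :
    (∑ p : V × V with r p.1 p.2, #{c | r p.1 c ∧ r p.2 c}) ^ 2 ≤
      #{p : V × V | r p.1 p.2} ^ 3 := by
  set E : Finset (V × V) := {p | r p.1 p.2} with hE
  have hsum : ∑ p ∈ E, #{c | r p.1 c ∧ r p.2 c} ^ 2 ≤ #E * #E := by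
    simp_rw [sq, ← card_product, ← card_sigma]
    refine card_le_card_of_injOn (fun x ↦ ((x.1.1, x.2.1), (x.1.2, x.2.2))) ?_ ?_
    · rintro ⟨⟨a, b⟩, c, d⟩ h
      simp_all
    · rintro ⟨⟨a, b⟩, c, d⟩ - ⟨⟨a', b'⟩, c', d'⟩ - h
      simp_all
  calc _ ≤ #E * ∑ p ∈ E, #{c | r p.1 c ∧ r p.2 c} ^ 2 := sq_sum_le_card_mul_sum_sq
    _ ≤ #E * (#E * #E) := by gcongr
    _ = #E ^ 3 := by ring

open Finset in
/-- In a graph with linearly ordered vertices, pairs of adjacent vertices in increasing order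
are at most as many as edges. -/
theorem SimpleGraph.card_adj_lt_le_card_edgeFinset {V : Type*} [Fintype V] [LinearOrder V]
    (G : SimpleGraph V) [DecidableRel G.Adj] :
    #{p : V × V | G.Adj p.1 p.2 ∧ p.1 < p.2} ≤ #G.edgeFinset := by
  refine card_le_card_of_injOn (fun p ↦ s(p.1, p.2)) ?_ ?_
  · rintro ⟨a, b⟩ h
    simp_all
  · rintro ⟨a, b⟩ h ⟨c, d⟩ h' heq
    simp only [coe_filter, mem_univ, true_and, Set.mem_ofPred_eq] at h h'
    rcases Sym2.eq_iff.mp heq with ⟨rfl, rfl⟩ | ⟨rfl, rfl⟩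
    · rfl
    · exact absurd h.2 h'.2.asymm

open Finset in
/-- In a graph with linearly ordered vertices, each triangle is spanned by an increasing triple
of pairwise adjacent vertices. -/
theorem SimpleGraph.card_cliqueFinset_three_le_sum {V : Type*} [Fintype V] [LinearOrder V]
    (G : SimpleGraph V) [DecidableRel G.Adj] :
    #(G.cliqueFinset 3) ≤ ∑ p : V × V with G.Adj p.1 p.2 ∧ p.1 < p.2,
      #{c | (G.Adj p.1 c ∧ p.1 < c) ∧ G.Adj p.2 c ∧ p.2 < c} := by
  rw [← card_sigma]
  refine card_le_card_of_surjOn (fun x ↦ {x.1.1, x.1.2, x.2}) ?_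
  intro s hs
  have hs : G.IsNClique 3 s := by simpa using hs
  have key : ∀ a b c, a < b → b < c → G.Adj a b → G.Adj a c → G.Adj b c →
      s = {a, b, c} → s ∈ (fun x : (_ : V × V) × V ↦ ({x.1.1, x.1.2, x.2} : Finset V)) ''
        (({p : V × V | G.Adj p.1 p.2 ∧ p.1 < p.2} : Finset (V × V)).sigma fun p ↦
          {c | (G.Adj p.1 c ∧ p.1 < c) ∧ G.Adj p.2 c ∧ p.2 < c} : Finset _) := by
    intro a b c hab hbc h₁ h₂ h₃ h
    exact ⟨⟨(a, b), c⟩, by simp [*, hab.trans hbc], h.symm⟩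
  obtain ⟨a, b, c, hab, hac, hbc, rfl⟩ := G.is3Clique_iff.mp hs
  rcases hab.ne.lt_or_gt with h₁ | h₁ <;> rcases hac.ne.lt_or_gt with h₂ | h₂ <;>
    rcases hbc.ne.lt_or_gt with h₃ | h₃
  · exact key a b c h₁ h₃ hab hac hbc rfl
  · exact key a c b h₂ h₃ hac hab hbc.symm (by grind)
  · exact absurd (h₁.trans h₃) h₂.asymm
  · exact key c a b h₂ h₁ hac.symm hbc.symm hab (by grind)
  · exact key b a c h₁ h₂ hab.symm hbc hac (by grind)
  · exact absurd (h₂.trans h₃) h₁.asymm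
  · exact key b c a h₃ h₂ hbc hab.symm hac.symm (by grind)
  · exact key c b a h₃ h₁ hbc.symm hac.symm hab.symm (by grind)

/-- A graph with `m` edges and `t` triangles satisfies `t ^ 2 ≤ m ^ 3`. -/
theorem SimpleGraph.card_cliqueFinset_three_sq_le {V : Type*} [Fintype V] [LinearOrder V]
    (G : SimpleGraph V) [DecidableRel G.Adj] :
    (G.cliqueFinset 3).card ^ 2 ≤ G.edgeFinset.card ^ 3 :=
  (Nat.pow_le_pow_left G.card_cliqueFinset_three_le_sum 2).trans <|
    (sq_sum_card_common_le_card_pow_three fun a b ↦ G.Adj a b ∧ a < b).trans <|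
      Nat.pow_le_pow_left G.card_adj_lt_le_card_edgeFinset 3

/-- Kruskal–Katona theorem, triangle form: every finite simple graph with `m` edges
contains at most `m^{3/2}` triangles. -/
theorem kruskal_katona_triangles {V : Type*} [Fintype V] [DecidableEq V]
    (G : SimpleGraph V) [DecidableRel G.Adj] :
    ((G.cliqueFinset 3).card : ℝ) ≤ (G.edgeFinset.card : ℝ) ^ ((3 : ℝ) / 2) := by
  let _ : LinearOrder V := LinearOrder.lift' (Fintype.equivFin V) (Fintype.equivFin V).injective
  have h : (G.cliqueFinset 3).card ^ 2 ≤ G.edgeFinset.card ^ 3 := by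
    convert G.card_cliqueFinset_three_sq_le
  refine le_of_pow_le_pow_left₀ two_ne_zero (by positivity) ?_
  rw [← Real.rpow_mul_natCast (by positivity)]
  norm_num
  exact_mod_cast h
end

section
/- There exists s₀ such that for every degree sequence of positive integers d_1, …, d_r with s = (1/2)·Σ_{i=1}^r d_i ≥ s₀, the expected number of triangles in the CL random graph is at most 3·s^{3/2}; equivalently, T ≤ 3·s^{3/2}. -/
open Finset

theorem min_one_le_sqrt {a : ℝ} (ha : 0 ≤ a) : min 1 a ≤ √a := by
  rcases le_total 1 a with h | h
  · exact (min_le_left _ _).trans (Real.one_le_sqrt.mpr h)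
  · exact (min_le_right _ _).trans (Real.le_sqrt_of_sq_le (by nlinarith))

theorem clP_nonneg {r : ℕ} (d : Fin r → ℕ) {s : ℝ} (hs : 0 ≤ s) (i j : Fin r) :
    0 ≤ clP d s i j :=
  le_min zero_le_one (by positivity)

theorem clP_le_sqrt_mul_sqrt {r : ℕ} (d : Fin r → ℕ) {s : ℝ} (hs : 0 ≤ s) (i j : Fin r) :
    clP d s i j ≤ √(d i / √(2 * s)) * √(d j / √(2 * s)) := by
  rw [← Real.sqrt_mul (by positivity), div_mul_div_comm, Real.mul_self_sqrt (by positivity)]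
  exact min_one_le_sqrt (by positivity)

theorem clP_mul_clP_mul_clP_le {r : ℕ} (d : Fin r → ℕ) {s : ℝ} (hs : 0 ≤ s) (i j k : Fin r) :
    clP d s i j * clP d s j k * clP d s i k ≤
      d i / √(2 * s) * (d j / √(2 * s) * (d k / √(2 * s))) := by
  have hx (l : Fin r) : √(d l / √(2 * s)) * √(d l / √(2 * s)) = d l / √(2 * s) :=
    Real.mul_self_sqrt (by positivity)
  calc
    _ ≤ √(d i / √(2 * s)) * √(d j / √(2 * s)) * (√(d j / √(2 * s)) * √(d k / √(2 * s))) *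
        (√(d i / √(2 * s)) * √(d k / √(2 * s))) := by
      gcongr
      all_goals first
        | exact clP_le_sqrt_mul_sqrt d hs _ _
        | exact clP_nonneg d hs _ _
    _ = _ := by
      linear_combination (√(d j / √(2 * s)) ^ 2 * √(d k / √(2 * s)) ^ 2) * hx i +
        (d i / √(2 * s) * √(d k / √(2 * s)) ^ 2) * hx j +
        (d i / √(2 * s) * (d j / √(2 * s))) * hx k

theorem clT_le_sum_pow_three {r : ℕ} (d : Fin r → ℕ) {s : ℝ} (hs : 0 ≤ s) :
    clT d s ≤ (∑ i, (d i : ℝ) / √(2 * s)) ^ 3 := by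
  calc
    clT d s ≤ ∑ t : Fin r × Fin r × Fin r,
        clP d s t.1 t.2.1 * clP d s t.2.1 t.2.2 * clP d s t.1 t.2.2 :=
      Finset.sum_le_sum_of_subset_of_nonneg (Finset.filter_subset _ _) fun t _ _ =>
        mul_nonneg (mul_nonneg (clP_nonneg d hs _ _) (clP_nonneg d hs _ _)) (clP_nonneg d hs _ _)
    _ ≤ ∑ t : Fin r × Fin r × Fin r,
        (d t.1 : ℝ) / √(2 * s) * (d t.2.1 / √(2 * s) * (d t.2.2 / √(2 * s))) :=
      Finset.sum_le_sum fun t _ => clP_mul_clP_mul_clP_le d hs _ _ _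
    _ = _ := by
      simp only [Fintype.sum_prod_type, ← Finset.mul_sum, ← Finset.sum_mul]
      ring

/-- There exists `s₀` such that for every degree sequence of positive integers with
`s = (∑ d i)/2 ≥ s₀`, the expected triangle count of the CL model satisfies
`T ≤ 3 s^{3/2}`. -/
theorem cl_expected_triangles_le :
    ∃ s₀ : ℝ, ∀ (r : ℕ) (d : Fin r → ℕ), (∀ i, 0 < d i) →
      ∀ s : ℝ, s = (∑ i, (d i : ℝ)) / 2 → s₀ ≤ s →
      clT d s ≤ 3 * s ^ ((3 : ℝ) / 2) := by
  refine ⟨1, fun r d _ s hsum hs => ?_⟩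
  have hs0 : 0 < s := by linarith
  refine (clT_le_sum_pow_three d hs0.le).trans ?_
  have hd : (∑ i, (d i : ℝ)) = 2 * s := by linarith
  have hpow : s ^ ((3 : ℝ) / 2) = √s ^ 3 := by
    rw [Real.sqrt_eq_rpow, ← Real.rpow_mul_natCast hs0.le]
    norm_num
  have htwo : √2 ^ 3 ≤ (3 : ℝ) := by
    have h : √2 ≤ (3 : ℝ) / 2 := Real.sqrt_le_iff.mpr ⟨by norm_num, by norm_num⟩
    nlinarith [Real.sq_sqrt (show (0 : ℝ) ≤ 2 by norm_num)]
  rw [← Finset.sum_div, hd, Real.div_sqrt, Real.sqrt_mul zero_le_two, mul_pow, hpow]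
  gcongr
end

section
/- Let c > 0 and κ ∈ (0,1). There exists s₀ (depending only on c and κ) such that the following holds. Let d_1, …, d_r be positive integers with s = (1/2)·Σ_{i=1}^r d_i ≥ s₀, let j be the number of indices i with d_i = 1, and let T be the expected triangle count of the CL model. If Σ_{i : d_i ≥ 2} d_i² ≥ c·j and T ≥ (κ/3)·Σ_{i=1}^r binom(d_i, 2) (with binom(1,2) = 0), then Σ_{i=1}^r d_i² ≤ (36·(c+1)/(κ·c))·s^{3/2}. -/
open Finset

/-- The Hilbert–Schmidt bound on a trilinear triangle sum. -/
theorem sq_sum_triangle_le {ι : Type*} [Fintype ι] (p : ι → ι → ℝ) :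
    (∑ i, ∑ j, ∑ k, p i j * p j k * p i k) ^ 2 ≤ (∑ i, ∑ j, p i j ^ 2) ^ 3 := by
  have hA : 0 ≤ ∑ i, ∑ j, p i j ^ 2 := by positivity
  have hS : ∑ i, ∑ j, ∑ k, p i j * p j k * p i k
      = ∑ x : ι × ι, p x.1 x.2 * ∑ k, p x.2 k * p x.1 k := by
    simp only [Fintype.sum_prod_type, mul_sum, mul_assoc]
  have h_inner : ∑ x : ι × ι, (∑ k, p x.2 k * p x.1 k) ^ 2 ≤ (∑ i, ∑ j, p i j ^ 2) ^ 2 := by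
    calc ∑ x : ι × ι, (∑ k, p x.2 k * p x.1 k) ^ 2
        ≤ ∑ x : ι × ι, (∑ k, p x.2 k ^ 2) * ∑ k, p x.1 k ^ 2 :=
          sum_le_sum fun x _ => sum_mul_sq_le_sq_mul_sq _ _ _
      _ = (∑ i, ∑ j, p i j ^ 2) ^ 2 := by
          rw [Fintype.sum_prod_type_right, sq, sum_mul_sum]
  calc (∑ i, ∑ j, ∑ k, p i j * p j k * p i k) ^ 2
      ≤ (∑ x : ι × ι, p x.1 x.2 ^ 2) * ∑ x : ι × ι, (∑ k, p x.2 k * p x.1 k) ^ 2 := by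
        rw [hS]
        exact sum_mul_sq_le_sq_mul_sq _ _ _
    _ ≤ (∑ i, ∑ j, p i j ^ 2) * (∑ i, ∑ j, p i j ^ 2) ^ 2 := by
        rw [Fintype.sum_prod_type]
        exact mul_le_mul_of_nonneg_left h_inner hA
    _ = (∑ i, ∑ j, p i j ^ 2) ^ 3 := by ring

theorem sum_clP_sq_le {r : ℕ} (d : Fin r → ℕ) {s : ℝ} (hs : 0 < s)
    (hd : ∑ i, (d i : ℝ) = 2 * s) : ∑ i, ∑ j, clP d s i j ^ 2 ≤ 2 * s := by
  calc ∑ i, ∑ j, clP d s i j ^ 2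
      ≤ ∑ i, ∑ j, (d i : ℝ) * (d j : ℝ) / (2 * s) := by
        refine sum_le_sum fun i _ => sum_le_sum fun j _ => ?_
        have h0 := clP_nonneg d hs.le i j
        have h1 : clP d s i j ≤ 1 := min_le_left _ _
        have h2 : clP d s i j ≤ (d i : ℝ) * (d j : ℝ) / (2 * s) := min_le_right _ _
        nlinarith
    _ = (∑ i, (d i : ℝ)) * (∑ j, (d j : ℝ)) / (2 * s) := by
        simp only [sum_mul_sum, sum_div]
    _ = 2 * s := by
        rw [hd]
        field_simp

theorem clT_le {r : ℕ} (d : Fin r → ℕ) {s : ℝ} (hs : 0 < s)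
    (hd : ∑ i, (d i : ℝ) = 2 * s) : clT d s ≤ 3 * s ^ ((3 : ℝ) / 2) := by
  have h0 := clP_nonneg d hs.le
  have hT : clT d s ≤ ∑ i, ∑ j, ∑ k, clP d s i j * clP d s j k * clP d s i k := by
    rw [clT]
    refine (sum_le_sum_of_subset_of_nonneg (filter_subset _ _) fun t _ _ =>
      mul_nonneg (mul_nonneg (h0 _ _) (h0 _ _)) (h0 _ _)).trans_eq ?_
    simp only [Fintype.sum_prod_type]
  refine hT.trans (le_of_sq_le_sq ?_ (by positivity))
  have h_pow : (s ^ ((3 : ℝ) / 2)) ^ 2 = s ^ 3 := by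
    rw [← Real.rpow_natCast, ← Real.rpow_mul hs.le, ← Real.rpow_natCast]
    norm_num
  calc (∑ i, ∑ j, ∑ k, clP d s i j * clP d s j k * clP d s i k) ^ 2
      ≤ (∑ i, ∑ j, clP d s i j ^ 2) ^ 3 := sq_sum_triangle_le _
    _ ≤ (2 * s) ^ 3 := by
        gcongr
        exact sum_clP_sq_le d hs hd
    _ ≤ (3 * s ^ ((3 : ℝ) / 2)) ^ 2 := by
        rw [mul_pow 3, h_pow]
        nlinarith [pow_pos hs 3]

theorem sum_sq_le_four_mul_sum_choose_two {r : ℕ} (d : Fin r → ℕ) :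
    ∑ i ∈ univ.filter (fun i => 2 ≤ d i), (d i : ℝ) ^ 2
      ≤ 4 * ∑ i, ((d i).choose 2 : ℝ) := by
  rw [mul_sum]
  refine (sum_le_sum fun i hi => ?_).trans
    (sum_le_sum_of_subset_of_nonneg (filter_subset _ _) fun i _ _ => by positivity)
  have h2 : (2 : ℝ) ≤ d i := by exact_mod_cast (mem_filter.mp hi).2
  rw [Nat.cast_choose_two]
  nlinarith

theorem sum_sq_eq_add_card {r : ℕ} (d : Fin r → ℕ) (hpos : ∀ i, 0 < d i) :
    ∑ i, (d i : ℝ) ^ 2 = ∑ i ∈ univ.filter (fun i => 2 ≤ d i), (d i : ℝ) ^ 2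
      + ((univ.filter (fun i => d i = 1)).card : ℝ) := by
  rw [← sum_filter_add_sum_filter_not univ (fun i => 2 ≤ d i)]
  congr 1
  have h_eq : univ.filter (fun i => ¬ 2 ≤ d i) = univ.filter (fun i => d i = 1) := by
    refine filter_congr fun i _ => ?_
    have := hpos i
    omega
  rw [h_eq, sum_congr rfl (g := fun _ => (1 : ℝ)) fun i hi => by simp [(mem_filter.mp hi).2]]
  simp

/-- There exists `s₀` (depending only on `c` and `κ`) such that: for every degree sequence
of positive integers with `s ≥ s₀`, if `∑_{d i ≥ 2} d i ^ 2 ≥ c j` (where `j` is the number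
of degree-1 indices) and the expected triangle count satisfies `T ≥ (κ/3) ∑ binom(d i, 2)`,
then `∑ d i ^ 2 ≤ (36 (c+1)/(κ c)) s^{3/2}`. -/
theorem cl_sum_sq_upper_bound (c : ℝ) (hc : 0 < c) (κ : ℝ) (hκ0 : 0 < κ) (hκ1 : κ < 1) :
    ∃ s₀ : ℝ, ∀ (r : ℕ) (d : Fin r → ℕ), (∀ i, 0 < d i) →
      ∀ s : ℝ, s = (∑ i, (d i : ℝ)) / 2 → s₀ ≤ s →
      (∑ i ∈ Finset.univ.filter (fun i => 2 ≤ d i), (d i : ℝ) ^ 2) ≥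
        c * ((Finset.univ.filter (fun i => d i = 1)).card : ℝ) →
      clT d s ≥ (κ / 3) * ∑ i, ((d i).choose 2 : ℝ) →
      ∑ i, (d i : ℝ) ^ 2 ≤ (36 * (c + 1) / (κ * c)) * s ^ ((3 : ℝ) / 2) := by
  refine ⟨1, fun r d hpos s hs hs1 hj hT => ?_⟩
  have hs0 : 0 < s := by linarith
  have hT' := clT_le d hs0 (by linarith)
  have hL := sum_sq_le_four_mul_sum_choose_two d
  rw [sum_sq_eq_add_card d hpos, div_mul_eq_mul_div, le_div_iff₀ (by positivity)]
  set L := ∑ i ∈ univ.filter (fun i => 2 ≤ d i), (d i : ℝ) ^ 2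
  set J := ((univ.filter (fun i => d i = 1)).card : ℝ)
  have h_bound : κ * L ≤ 36 * s ^ ((3 : ℝ) / 2) := by
    linarith [mul_le_mul_of_nonneg_left hL hκ0.le]
  calc (L + J) * (κ * c) = κ * (c * L + c * J) := by ring
    _ ≤ κ * (c * L + L) := by gcongr
    _ = (c + 1) * (κ * L) := by ring
    _ ≤ (c + 1) * (36 * s ^ ((3 : ℝ) / 2)) := by gcongr
    _ = 36 * (c + 1) * s ^ ((3 : ℝ) / 2) := by ring
end

section
/- Let d_1, …, d_r be positive integers with s = (1/2)·Σ_{i=1}^r d_i > 0, and let b, γ, τ be constants with 0 < 2γ < τ ≤ b. Suppose Σ_{i ∈ A} d_i² ≥ τ·s^{3/2}, where A = {i : d_i ≤ b·√s}. Then the set M = {i : γ·√s ≤ d_i ≤ b·√s} satisfies Σ_{i ∈ M} d_i ≥ ((τ − 2γ)/(b − γ))·s, and consequently the number of indices in M is at least ((τ − 2γ)/(b·(b − γ)))·√s. -/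
open Finset

/-- If the indices with `d i ≤ b √s` carry squared-degree mass at least `τ s^{3/2}`,
with `0 < 2γ < τ ≤ b`, then the indices with `γ √s ≤ d i ≤ b √s` carry degree mass at
least `((τ - 2γ)/(b - γ)) s`, and there are at least `((τ - 2γ)/(b (b - γ))) √s` of them. -/
theorem mid_degree_mass_bound (r : ℕ) (d : Fin r → ℕ) (hd : ∀ i, 0 < d i)
    (s : ℝ) (hs : s = (∑ i, (d i : ℝ)) / 2) (hs0 : 0 < s)
    (b γ τ : ℝ) (hγ : 0 < γ) (hγτ : 2 * γ < τ) (hτb : τ ≤ b)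
    (hA : ∑ i ∈ Finset.univ.filter (fun i => (d i : ℝ) ≤ b * Real.sqrt s), (d i : ℝ) ^ 2 ≥
      τ * s ^ ((3 : ℝ) / 2)) :
    (∑ i ∈ Finset.univ.filter
        (fun i => γ * Real.sqrt s ≤ (d i : ℝ) ∧ (d i : ℝ) ≤ b * Real.sqrt s), (d i : ℝ)) ≥
      ((τ - 2 * γ) / (b - γ)) * s ∧
    ((Finset.univ.filter
        (fun i => γ * Real.sqrt s ≤ (d i : ℝ) ∧ (d i : ℝ) ≤ b * Real.sqrt s)).card : ℝ) ≥
      ((τ - 2 * γ) / (b * (b - γ))) * Real.sqrt s := by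
  set t := Real.sqrt s with ht
  have ht0 : 0 < t := Real.sqrt_pos.mpr hs0
  have hst : s = t ^ 2 := (Real.sq_sqrt hs0.le).symm
  have hpow : s ^ ((3 : ℝ) / 2) = t ^ 3 := by
    rw [ht, Real.sqrt_eq_rpow, ← Real.rpow_mul_natCast hs0.le]
    norm_num
  have hbγ : 0 < b - γ := by linarith
  have hb : 0 < b := by linarith
  have hsum : ∑ i, (d i : ℝ) = 2 * t ^ 2 := by linarith
  have key : ∑ i with (d i : ℝ) ≤ b * t, (d i : ℝ) ^ 2 ≤ γ * t * ∑ i, (d i : ℝ) +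
      (b - γ) * t * ∑ i with γ * t ≤ (d i : ℝ) ∧ (d i : ℝ) ≤ b * t, (d i : ℝ) := by
    rw [Finset.sum_filter, Finset.sum_filter, Finset.mul_sum, Finset.mul_sum,
      ← Finset.sum_add_distrib]
    refine Finset.sum_le_sum fun i _ => ?_
    have hdi : (0 : ℝ) ≤ d i := Nat.cast_nonneg _
    have hγt : 0 ≤ γ * t * d i := by positivity
    by_cases h1 : (d i : ℝ) ≤ b * t
    · by_cases h2 : γ * t ≤ (d i : ℝ)
      · simp only [h1, h2, and_self, if_true]
        nlinarith [mul_le_mul_of_nonneg_right h1 hdi]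
      · simp only [h1, h2, false_and, if_true, if_false]
        nlinarith [mul_le_mul_of_nonneg_right (not_le.mp h2).le hdi]
    · simpa [h1] using hγt
  have mass : (∑ i with γ * t ≤ (d i : ℝ) ∧ (d i : ℝ) ≤ b * t, (d i : ℝ)) ≥
      ((τ - 2 * γ) / (b - γ)) * s := by
    rw [hsum] at key
    rw [hpow] at hA
    rw [ge_iff_le, div_mul_eq_mul_div, div_le_iff₀ hbγ, hst]
    refine le_of_mul_le_mul_right ?_ ht0
    linarith
  refine ⟨mass, ?_⟩
  have card_bound := Finset.sum_le_card_nsmul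
    (Finset.univ.filter fun i => γ * t ≤ (d i : ℝ) ∧ (d i : ℝ) ≤ b * t)
    (fun i => (d i : ℝ)) (b * t) fun i hi => (Finset.mem_filter.mp hi).2.2
  rw [nsmul_eq_mul] at card_bound
  refine le_of_mul_le_mul_right ?_ (mul_pos hb ht0)
  calc (τ - 2 * γ) / (b * (b - γ)) * t * (b * t) = (τ - 2 * γ) / (b - γ) * s := by
        rw [hst]
        field_simp
    _ ≤ _ := mass.le.trans card_bound
end
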